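/- Let M be a compact metric space. Then M is purely 1-unrectifiable if and only if for every 1-Lipschitz function f : M → ℝ and every ε > 0 there exists a 1-Lipschitz locally flat function g : M → ℝ with sup_{x ∈ M} |f(x) − g(x)| ≤ ε. -/

import Mathlib

open Metric Set MeasureTheory
open scoped ENNReal NNReal

/-- A Lipschitz function `f : M → ℝ` is *locally flat* if for every point `p` and every
`ε > 0` there is `δ > 0` such that `|f x - f y| ≤ ε * d(x,y)` whenever `x, y` are within
distance `δ` of `p`. -/
def LocallyFlat {M : Type*} [MetricSpace M] (f : M → ℝ) : Prop :=
  ∀ p : M, ∀ ε : ℝ, 0 < ε → ∃ δ : ℝ, 0 < δ ∧ ∀ x y : M,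
    dist x p < δ → dist y p < δ → |f x - f y| ≤ ε * dist x y

/-- A metric space `M` is *purely 1-unrectifiable* if for every `A ⊆ ℝ` and every Lipschitz
map `f : A → M`, the 1-dimensional Hausdorff measure of `f(A)` is zero. -/
def Purely1Unrectifiable (M : Type*) [MetricSpace M] [MeasurableSpace M] [BorelSpace M] :
    Prop :=
  ∀ (A : Set ℝ) (f : ℝ → M) (K : ℝ≥0), LipschitzOnWith K f A → μH[1] (f '' A) = 0


inductive CChain {M : Type*} (c : M → M → ℝ) : M → M → ℝ → Prop
  | nil (x : M) : CChain c x x 0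
  | cons (x y z : M) (r : ℝ) : CChain c y z r → CChain c x z (c x y + r)

namespace CChain
variable {M : Type*} {c : M → M → ℝ}

lemma single (x y : M) : CChain c x y (c x y) := by
  simpa using CChain.cons x y y 0 (CChain.nil (c := c) y)

lemma append {x y z : M} {r s : ℝ} (h1 : CChain c x y r) (h2 : CChain c y z s) :
    CChain c x z (r + s) := by
  induction h1 with
  | nil x => simpa using h2
  | cons x y w r h ih => simpa [add_assoc] using CChain.cons _ _ _ _ (ih h2)

lemma symm (hs : ∀ x y, c x y = c y x) {x y : M} {r : ℝ} (h : CChain c x y r) :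
    CChain c y x r := by
  induction h with
  | nil x => exact CChain.nil x
  | cons x y w r h ih =>
    rw [add_comm, hs x y]
    exact ih.append (single y x)

lemma le_of {p : M → M → ℝ} (p0 : ∀ x, p x x = 0) (pt : ∀ x y z, p x z ≤ p x y + p y z)
    (pc : ∀ x y, p x y ≤ c x y) {x y : M} {r : ℝ} (h : CChain c x y r) : p x y ≤ r := by
  induction h with
  | nil x => exact (p0 x).le
  | cons x y w r h ih => linarith [pt x y w, pc x y]

lemma nonneg (hc : ∀ x y, 0 ≤ c x y) {x y : M} {r : ℝ} (h : CChain c x y r) : 0 ≤ r :=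
  h.le_of (p := fun _ _ => 0) (by simp) (by simp) hc

lemma jump {S : Set M} {x y : M} {r : ℝ} (h : CChain c x y r) (hx : x ∈ S) (hy : y ∉ S) :
    ∃ a b r1 r2, a ∈ S ∧ b ∉ S ∧ CChain c x a r1 ∧ CChain c b y r2 ∧ r1 + c a b + r2 = r := by
  induction h with
  | nil x => exact absurd hx hy
  | cons x y w r h ih =>
    by_cases hyS : y ∈ S
    · obtain ⟨a, b, r1, r2, ha, hb, h1, h2, e⟩ := ih hyS hy
      exact ⟨a, b, _, r2, ha, hb, CChain.cons _ _ _ _ h1, h2, by linarith⟩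
    · exact ⟨x, y, 0, r, hx, hyS, CChain.nil x, h, by ring⟩

end CChain

noncomputable def cD {M : Type*} (c : M → M → ℝ) (x y : M) : ℝ := sInf {r | CChain c x y r}

section cD
variable {M : Type*} {c : M → M → ℝ}

lemma cD_bdd (hc : ∀ x y, 0 ≤ c x y) (x y : M) : BddBelow {r | CChain c x y r} :=
  ⟨0, fun _ hr => hr.nonneg hc⟩

lemma cD_ne (x y : M) : {r | CChain c x y r}.Nonempty := ⟨_, CChain.single x y⟩

lemma cD_le_of (hc : ∀ x y, 0 ≤ c x y) {x y : M} {r : ℝ} (h : CChain c x y r) : cD c x y ≤ r :=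
  csInf_le (cD_bdd hc x y) h

lemma cD_le (hc : ∀ x y, 0 ≤ c x y) (x y : M) : cD c x y ≤ c x y :=
  cD_le_of hc (CChain.single x y)

lemma le_cD {p : M → M → ℝ} (p0 : ∀ x, p x x = 0) (pt : ∀ x y z, p x z ≤ p x y + p y z)
    (pc : ∀ x y, p x y ≤ c x y) (x y : M) : p x y ≤ cD c x y :=
  le_csInf (cD_ne x y) fun _ hr => hr.le_of p0 pt pc

lemma cD_nonneg (hc : ∀ x y, 0 ≤ c x y) (x y : M) : 0 ≤ cD c x y :=
  le_csInf (cD_ne x y) fun _ hr => hr.nonneg hc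

lemma cD_self (hc : ∀ x y, 0 ≤ c x y) (x : M) : cD c x x = 0 :=
  le_antisymm (cD_le_of hc (CChain.nil x)) (cD_nonneg hc x x)

lemma cD_near (x y : M) {θ : ℝ} (hθ : 0 < θ) : ∃ r, CChain c x y r ∧ r < cD c x y + θ := by
  obtain ⟨r, hr, h⟩ := exists_lt_of_csInf_lt (cD_ne (c := c) x y) (lt_add_of_pos_right _ hθ)
  exact ⟨r, hr, h⟩

lemma cD_triangle (hc : ∀ x y, 0 ≤ c x y) (x y z : M) : cD c x z ≤ cD c x y + cD c y z := by
  refine le_of_forall_pos_lt_add fun θ hθ => ?_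
  obtain ⟨r, hr, h⟩ := cD_near (c := c) x y (half_pos hθ)
  obtain ⟨s, hs, h'⟩ := cD_near (c := c) y z (half_pos hθ)
  have := cD_le_of hc (hr.append hs)
  linarith

lemma cD_symm (hs : ∀ x y, c x y = c y x) (x y : M) : cD c x y = cD c y x := by
  unfold cD
  congr 1
  ext r
  exact ⟨fun h => CChain.symm hs h, fun h => CChain.symm hs h⟩

lemma cD_jump (hc : ∀ x y, 0 ≤ c x y) {S : Set M} {x y : M} (hx : x ∈ S) (hy : y ∉ S)
    {θ : ℝ} (hθ : 0 < θ) :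
    ∃ a b, a ∈ S ∧ b ∉ S ∧ cD c x a + c a b + cD c b y < cD c x y + θ := by
  obtain ⟨r, hr, h⟩ := cD_near (c := c) x y hθ
  obtain ⟨a, b, r1, r2, ha, hb, h1, h2, e⟩ := hr.jump hx hy
  exact ⟨a, b, ha, hb, by linarith [cD_le_of hc h1, cD_le_of hc h2]⟩

end cD

lemma gapcover {A : Set ℝ} (hA : IsCompact A) {a b : ℝ} (ha : a ∈ A) (hb : b ∈ A)
    (hab : A ⊆ Icc a b) (h : ℝ → ℝ) (hh : ContinuousOn h A) (h0 : volume (h '' A) = 0)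
    (gap : ∀ s ∈ A, ∀ t ∈ A, s < t → (∀ r ∈ A, ¬ (s < r ∧ r < t)) → |h s - h t| ≤ t - s) :
    h b - h a ≤ b - a := by
  have hle : a ≤ b := (hab ha).2
  rcases lt_or_ge (h b) (h a) with hlt | hge
  · linarith
  let G : Set ℝ := {s | s ∈ A ∧ ∃ t ∈ A, s < t ∧ ∀ r ∈ A, ¬ (s < r ∧ r < t)}
  have hG : ∀ s : ℝ, ∃ t, s ∈ G → (t ∈ A ∧ s < t ∧ ∀ r ∈ A, ¬ (s < r ∧ r < t)) := by
    intro s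
    by_cases hs : s ∈ G
    · obtain ⟨_, t, ht⟩ := hs
      exact ⟨t, fun _ => ht⟩
    · exact ⟨0, fun h => absurd h hs⟩
  choose n hn using hG
  have hdisj : G.PairwiseDisjoint (fun s => Ioo s (n s)) := by
    intro s hs t ht hst
    rw [Function.onFun, Set.disjoint_left]
    intro r hr hr'
    rcases lt_or_gt_of_ne hst with h1 | h1
    · exact (hn s hs).2.2 t ht.1 ⟨h1, hr'.1.trans hr.2⟩
    · exact (hn t ht).2.2 s hs.1 ⟨h1, hr.1.trans hr'.2⟩
  have hcount : G.Countable := hdisj.countable_of_Ioo fun s hs => (hn s hs).2.1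
  have hcov : Icc (h a) (h b) ⊆ h '' A ∪ ⋃ s ∈ G, Icc (h s) (h (n s)) := by
    intro r hr
    let B := A ∩ h ⁻¹' Iic r
    have hBc : IsCompact B := by
      obtain ⟨u, hu, e⟩ := (continuousOn_iff_isClosed.1 hh) (Iic r) isClosed_Iic
      have : B = A ∩ u := by
        change A ∩ h ⁻¹' Iic r = _
        rw [inter_comm, e, inter_comm]
      rw [this]
      exact hA.inter_right hu
    obtain ⟨s, hs, hsm⟩ := hBc.exists_isGreatest ⟨a, ha, hr.1⟩
    by_cases hrs : h s = r
    · exact Or.inl ⟨s, hs.1, hrs⟩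
    have hsr : h s < r := lt_of_le_of_ne hs.2 hrs
    right
    -- neighbourhood of s
    have hnear : ∀ᶠ t in nhdsWithin s A, h t < r := (hh s hs.1).eventually_lt_const hsr
    obtain ⟨δ, hδ, hball⟩ := Metric.mem_nhdsWithin_iff.1 hnear
    have hA2 : IsCompact (A ∩ Ici (s + δ)) := hA.inter_right isClosed_Ici
    have hAs : ∀ t ∈ A, s < t → s + δ ≤ t := by
      intro t ht hst
      by_contra hcon
      push Not at hcon
      have : h t < r := hball ⟨by rw [Metric.mem_ball, Real.dist_eq, abs_of_pos (by linarith)]; linarith, ht⟩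
      exact absurd (hsm ⟨ht, this.le⟩) (not_le.2 hst)
    have hsb : s < b := by
      refine lt_of_le_of_ne (hab hs.1).2 ?_
      rintro rfl
      exact absurd hr.2 (not_le.2 hsr)
    obtain ⟨t, ht, htm⟩ := hA2.exists_isLeast ⟨b, hb, hAs b hb hsb⟩
    have ht2 : s + δ ≤ t := ht.2
    have hsG : s ∈ G := ⟨hs.1, t, ht.1, by linarith, fun q hq hq' =>
      absurd (htm ⟨hq, hAs q hq hq'.1⟩) (not_le.2 hq'.2)⟩
    refine mem_iUnion₂.2 ⟨s, hsG, hs.2, ?_⟩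
    by_contra hcon
    push Not at hcon
    exact absurd (hsm ⟨(hn s hsG).1, hcon.le⟩) (not_le.2 (hn s hsG).2.1)
  have hm : volume (Icc (h a) (h b)) ≤ ENNReal.ofReal (b - a) := by
    calc volume (Icc (h a) (h b)) ≤ volume (h '' A ∪ ⋃ s ∈ G, Icc (h s) (h (n s))) :=
          measure_mono hcov
      _ ≤ volume (h '' A) + volume (⋃ s ∈ G, Icc (h s) (h (n s))) := measure_union_le _ _
      _ = volume (⋃ s ∈ G, Icc (h s) (h (n s))) := by rw [h0, zero_add]
      _ ≤ ∑' s : G, volume (Icc (h s) (h (n s))) := measure_biUnion_le _ hcount _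
      _ ≤ ∑' s : G, volume (Ioo (s : ℝ) (n s)) := by
          refine ENNReal.tsum_le_tsum fun s => ?_
          rw [Real.volume_Icc, Real.volume_Ioo]
          apply ENNReal.ofReal_le_ofReal
          have := gap s s.2.1 (n s) (hn s s.2).1 (hn s s.2).2.1 (hn s s.2).2.2
          rw [abs_sub_comm] at this
          exact (le_abs_self _).trans this
      _ = volume (⋃ s ∈ G, Ioo (s : ℝ) (n s)) := 
          (measure_biUnion hcount hdisj fun s _ => measurableSet_Ioo).symm
      _ ≤ volume (Icc a b) := by
          apply measure_mono
          refine iUnion₂_subset fun s hs r hr => ?_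
          exact ⟨(hab hs.1).1.trans hr.1.le, hr.2.le.trans (hab (hn s hs).1).2⟩
      _ = ENNReal.ofReal (b - a) := Real.volume_Icc
  rw [Real.volume_Icc] at hm
  exact (ENNReal.ofReal_le_ofReal_iff (by linarith)).1 hm

lemma cont_of_tri {M : Type*} [MetricSpace M] {D : M → M → ℝ}
    (Dt : ∀ x y z, D x z ≤ D x y + D y z)
    (Dd : ∀ x y, D x y ≤ dist x y) : Continuous (fun p : M × M => D p.1 p.2) := by
  refine LipschitzWith.continuous (K := 2) (LipschitzWith.of_dist_le_mul fun p q => ?_)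
  have h1 : dist p.1 q.1 ≤ dist p q := le_max_left _ _
  have h2 : dist p.2 q.2 ≤ dist p q := le_max_right _ _
  rw [Real.dist_eq, abs_le]
  push_cast
  constructor
  · linarith [Dt q.1 p.1 q.2, Dt p.1 p.2 q.2, Dd q.1 p.1, Dd p.2 q.2, dist_comm p.1 q.1]
  · linarith [Dt p.1 q.1 p.2, Dt q.1 q.2 p.2, Dd p.1 q.1, Dd q.2 p.2, dist_comm p.2 q.2]

lemma geod {M : Type*} [MetricSpace M] [CompactSpace M] [MeasurableSpace M] [BorelSpace M]
    (hM : Purely1Unrectifiable M) {D : M → M → ℝ} {e : ℝ} (he : 0 < e)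
    (D0 : ∀ x, D x x = 0) (Ds : ∀ x y, D x y = D y x) (Dt : ∀ x y z, D x z ≤ D x y + D y z)
    (De : ∀ x y, e * dist x y ≤ D x y) (Dd : ∀ x y, D x y ≤ dist x y)
    {f : M → ℝ} (hf : LipschitzWith 1 f)
    (gap : ∀ u v, u ≠ v → (∀ z, D u z + D z v = D u v → z = u ∨ z = v) → |f u - f v| ≤ D u v)
    (x y : M) : f y - f x ≤ D x y := by
  have Dc := cont_of_tri Dt Dd
  have Dnn : ∀ x y, 0 ≤ D x y := fun x y => (by positivity : 0 ≤ e * dist x y).trans (De x y)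
  have Deq : ∀ x y, D x y ≤ 0 → x = y := by
    intro x y h
    have h1 := De x y
    have : dist x y ≤ 0 := by
      by_contra hc
      push Not at hc
      have := mul_pos he hc
      linarith
    exact dist_le_zero.1 this
  have Dcx : Continuous (fun z => D x z) := Dc.comp (Continuous.prodMk continuous_const continuous_id)
  let P : Set (Set M) := {Γ | (∀ z ∈ Γ, ∀ w ∈ Γ, |D x z - D x w| = D z w) ∧
    ∀ z ∈ Γ, D x z ≤ D x y}
  have hP0 : ({x, y} : Set M) ∈ P := by
    have h1 := D0 x
    have h2 := D0 y
    have h3 := Dnn x y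
    refine ⟨?_, ?_⟩
    · rintro z (rfl | rfl) w (rfl | rfl)
      · simp [D0]
      · simp [D0, abs_of_nonneg h3]
      · rw [D0, Ds _ w, sub_zero, abs_of_nonneg h3]
      · simp [D0]
    · rintro z (rfl | rfl)
      · linarith
      · exact le_rfl
  obtain ⟨Γ, hsub, hmax⟩ := zorn_subset_nonempty P (by
    intro C hC hch hne
    refine ⟨⋃₀ C, ⟨?_, ?_⟩, fun s hs => subset_sUnion_of_mem hs⟩
    · rintro z ⟨s, hs, hz⟩ w ⟨t, ht, hw⟩
      rcases hch.total hs ht with h | h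
      · exact (hC ht).1 z (h hz) w hw
      · exact (hC hs).1 z hz w (h hw)
    · rintro z ⟨s, hs, hz⟩
      exact (hC hs).2 z hz) _ hP0
  have hΓ : Γ ∈ P := hmax.prop
  have hxΓ : x ∈ Γ := hsub (by simp)
  have hyΓ : y ∈ Γ := hsub (by simp)
  have hclosed : IsClosed Γ := by
    have hcl : closure Γ ∈ P := by
      refine ⟨?_, ?_⟩
      · have h1 : IsClosed {p : M × M | |D x p.1 - D x p.2| = D p.1 p.2} := 
          isClosed_eq (((Dcx.comp continuous_fst).sub (Dcx.comp continuous_snd)).abs) Dc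
        have h2 : closure (Γ ×ˢ Γ) ⊆ {p : M × M | |D x p.1 - D x p.2| = D p.1 p.2} :=
          closure_minimal (fun p hp => hΓ.1 p.1 hp.1 p.2 hp.2) h1
        rw [closure_prod_eq] at h2
        intro z hz w hw
        exact h2 (show (z, w) ∈ _ from ⟨hz, hw⟩)
      · exact closure_minimal (t := {z | D x z ≤ D x y}) hΓ.2 (isClosed_le Dcx continuous_const)
    exact isClosed_of_closure_subset (hmax.le_of_ge hcl subset_closure)
  let A := (fun z => D x z) '' Γ
  have hAc : IsCompact A := hclosed.isCompact.image Dcx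
  have hinj : ∀ z ∈ Γ, ∀ w ∈ Γ, D x z = D x w → z = w := by
    intro z hz w hw h
    apply Deq
    rw [← hΓ.1 z hz w hw, h]; simp
  have hex : ∀ t : ℝ, ∃ z, t ∈ A → z ∈ Γ ∧ D x z = t := by
    intro t
    by_cases ht : t ∈ A
    · obtain ⟨z, hz, e⟩ := ht
      exact ⟨z, fun _ => ⟨hz, e⟩⟩
    · exact ⟨x, fun h => absurd h ht⟩
  choose γ hγ using hex
  have hγx : γ 0 = x := by
    have h0 : (0:ℝ) ∈ A := ⟨x, hxΓ, D0 x⟩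
    exact hinj _ (hγ 0 h0).1 _ hxΓ ((hγ 0 h0).2.trans (D0 x).symm)
  have hγy : γ (D x y) = y := by
    have h0 : D x y ∈ A := ⟨y, hyΓ, rfl⟩
    exact hinj _ (hγ _ h0).1 _ hyΓ ((hγ _ h0).2)
  have hγD : ∀ s ∈ A, ∀ t ∈ A, D (γ s) (γ t) = |s - t| := by
    intro s hs t ht
    rw [← hΓ.1 _ (hγ s hs).1 _ (hγ t ht).1, (hγ s hs).2, (hγ t ht).2]
  have hlip : LipschitzOnWith (Real.toNNReal e⁻¹) γ A := by
    refine LipschitzOnWith.of_dist_le_mul fun s hs t ht => ?_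
    rw [Real.coe_toNNReal _ (by positivity), Real.dist_eq, ← hγD s hs t ht]
    have := De (γ s) (γ t)
    rw [inv_mul_eq_div, le_div_iff₀ he]
    linarith
  have hnull : volume ((f ∘ γ) '' A) = 0 := by
    have h1 := hM A γ _ hlip
    have h2 := hf.hausdorffMeasure_image_le (d := 1) zero_le_one (γ '' A)
    rw [h1, mul_zero, hausdorffMeasure_real] at h2
    rw [image_comp]
    exact le_antisymm h2 bot_le
  have key := gapcover hAc (a := 0) (b := D x y) ⟨x, hxΓ, D0 x⟩ ⟨y, hyΓ, rfl⟩ (by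
    rintro _ ⟨z, hz, rfl⟩
    exact ⟨Dnn _ _, hΓ.2 z hz⟩) (f ∘ γ) (hf.continuous.comp_continuousOn hlip.continuousOn) hnull (by
    intro s hs t ht hst hgap
    have hD := hγD s hs t ht
    rw [abs_sub_comm, abs_of_pos (by linarith)] at hD
    have hu := hγ s hs
    have hv := hγ t ht
    rw [← hD]
    refine gap _ _ ?_ ?_
    · intro h
      rw [h, D0] at hD
      linarith
    · intro z hz
      by_contra hne
      push Not at hne
      set u := γ s
      set v := γ t
      have hxz : D x z = D x u + D u z := by
        apply le_antisymm (Dt _ _ _)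
        linarith [Dt x z v]
      have hz1 : 0 < D u z := by
        by_contra hc
        exact hne.1 (Deq _ _ (not_lt.1 hc)).symm
      have hz2 : 0 < D z v := by
        by_contra hc
        exact hne.2 (Deq _ _ (not_lt.1 hc))
      have hdist : ∀ w ∈ Γ, |D x z - D x w| = D z w := by
        intro w hw
        have hwA : D x w ∈ A := ⟨w, hw, rfl⟩
        have hcase : D x w ≤ s ∨ t ≤ D x w := by
          by_contra hc
          push Not at hc
          exact hgap _ hwA hc
        have e1 := hΓ.1 w hw u hu.1
        have e2 := hΓ.1 w hw v hv.1
        rcases hcase with h | h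
        · rw [abs_of_nonpos (by linarith)] at e1 e2
          rw [abs_of_nonneg (by linarith)]
          linarith [Dt w z v, Dt w u z, Ds z w]
        · rw [abs_of_nonneg (by linarith)] at e1 e2
          rw [abs_of_nonpos (by linarith)]
          linarith [Dt w z u, Dt w v z, Ds z w, Ds z u, Ds z v]
      have hins : insert z Γ ∈ P := by
        refine ⟨?_, ?_⟩
        · rintro a (rfl | ha) b (rfl | hb)
          · simp [D0]
          · exact hdist b hb
          · rw [abs_sub_comm, Ds a b]; exact hdist a ha
          · exact hΓ.1 a ha b hb
        · rintro a (rfl | ha)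
          · linarith [hΓ.2 v hv.1]
          · exact hΓ.2 a ha
      have hzΓ : z ∈ Γ := hmax.le_of_ge hins (subset_insert _ _) (mem_insert _ _)
      exact hgap (D x z) ⟨z, hzΓ, rfl⟩ ⟨by linarith, by linarith⟩)
  simp only [Function.comp, hγx, hγy] at key
  linarith

open Filter Topology in
lemma flat_step {M : Type*} [MetricSpace M] [CompactSpace M] [MeasurableSpace M] [BorelSpace M]
    (hM : Purely1Unrectifiable M) {c : M → M → ℝ} {e : ℝ} (he : 0 < e)
    (cs : ∀ x y, c x y = c y x) (ce : ∀ x y, e * dist x y ≤ c x y)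
    (cd : ∀ x y, c x y ≤ dist x y) {f : M → ℝ} (hf : ∀ x y, |f x - f y| ≤ c x y)
    {τ : ℝ} (hτ : 0 < τ) :
    ∃ δ > 0, ∃ g : M → ℝ, (∀ x, |f x - g x| ≤ τ) ∧
      ∀ x y, |g x - g y| ≤ if dist x y < δ then e * dist x y else c x y := by
  let ck : ℕ → M → M → ℝ := fun k x y => if dist x y < 1 / ((k : ℝ) + 1) then e * dist x y else c x y
  have ck_e : ∀ k x y, e * dist x y ≤ ck k x y := by
    intro k x y
    by_cases h : dist x y < 1 / ((k : ℝ) + 1)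
    · simp only [ck, if_pos h, le_refl]
    · simp only [ck, if_neg h, ce]
  have ck_c : ∀ k x y, ck k x y ≤ c x y := by
    intro k x y
    by_cases h : dist x y < 1 / ((k : ℝ) + 1)
    · simp only [ck, if_pos h, ce]
    · simp only [ck, if_neg h, le_refl]
  have ck0 : ∀ k x y, 0 ≤ ck k x y := fun k x y =>
    (by positivity : 0 ≤ e * dist x y).trans (ck_e k x y)
  have ck_s : ∀ k x y, ck k x y = ck k y x := by
    intro k x y
    simp only [ck, dist_comm x y, cs x y]
  have ck_mono : ∀ k l, k ≤ l → ∀ x y, ck k x y ≤ ck l x y := by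
    intro k l hkl x y
    by_cases h : dist x y < 1 / ((l : ℝ) + 1)
    · have h' : dist x y < 1 / ((k : ℝ) + 1) := h.trans_le (Nat.one_div_le_one_div hkl)
      simp only [ck, if_pos h, if_pos h', le_refl]
    · have : ck l x y = c x y := by simp only [ck, if_neg h]
      rw [this]; exact ck_c k x y
  let Dk : ℕ → M → M → ℝ := fun k => cD (ck k)
  have Dk_t : ∀ k x y z, Dk k x z ≤ Dk k x y + Dk k y z := fun k => cD_triangle (ck0 k)
  have Dk_s : ∀ k x y, Dk k x y = Dk k y x := fun k => cD_symm (ck_s k)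
  have Dk_0 : ∀ k x, Dk k x x = 0 := fun k => cD_self (ck0 k)
  have Dk_nn : ∀ k x y, 0 ≤ Dk k x y := fun k => cD_nonneg (ck0 k)
  have Dk_ck : ∀ k x y, Dk k x y ≤ ck k x y := fun k => cD_le (ck0 k)
  have Dk_d : ∀ k x y, Dk k x y ≤ dist x y := fun k x y =>
    (Dk_ck k x y).trans ((ck_c k x y).trans (cd x y))
  have Dk_e : ∀ k x y, e * dist x y ≤ Dk k x y := by
    intro k x y
    refine le_cD (p := fun x y => e * dist x y) (by simp) ?_ (ck_e k) x y
    intro x y z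
    rw [← mul_add]
    exact mul_le_mul_of_nonneg_left (dist_triangle _ _ _) he.le
  have Dk_mono : ∀ k l, k ≤ l → ∀ x y, Dk k x y ≤ Dk l x y := fun k l hkl x y =>
    le_cD (Dk_0 k) (Dk_t k) (fun x y => (Dk_ck k x y).trans (ck_mono k l hkl x y)) x y
  have hlim : ∀ x y, ∃ d, Tendsto (fun k => Dk k x y) atTop (𝓝 d) := fun x y =>
    ⟨_, tendsto_atTop_ciSup (fun k l hkl => Dk_mono k l hkl x y)
      ⟨dist x y, by rintro _ ⟨k, rfl⟩; exact Dk_d k x y⟩⟩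
  choose D hD using hlim
  have D_ge : ∀ k x y, Dk k x y ≤ D x y := fun k x y =>
    (show Monotone (fun k => Dk k x y) from fun k l hkl => Dk_mono k l hkl x y).ge_of_tendsto (hD x y) k
  have D_0 : ∀ x, D x x = 0 := fun x =>
    tendsto_nhds_unique (hD x x) (by simp only [Dk_0]; exact tendsto_const_nhds)
  have D_s : ∀ x y, D x y = D y x := fun x y =>
    tendsto_nhds_unique (hD x y) (by simp only [Dk_s _ x y]; exact hD y x)
  have D_t : ∀ x y z, D x z ≤ D x y + D y z := fun x y z =>
    le_of_tendsto_of_tendsto' (hD x z) ((hD x y).add (hD y z)) fun k => Dk_t k x y z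
  have D_d : ∀ x y, D x y ≤ dist x y := fun x y => le_of_tendsto' (hD x y) fun k => Dk_d k x y
  have D_e : ∀ x y, e * dist x y ≤ D x y := fun x y => (Dk_e 0 x y).trans (D_ge 0 x y)
  have D_cont := cont_of_tri D_t D_d
  have hunif : TendstoUniformly (fun k (p : M × M) => Dk k p.1 p.2) (fun p => D p.1 p.2) atTop :=
    Monotone.tendstoUniformly_of_forall_tendsto (fun k => cont_of_tri (Dk_t k) (Dk_d k))
      (fun k l hkl p => Dk_mono k l hkl p.1 p.2) D_cont (fun p => hD p.1 p.2)
  have hU : ∀ θ > 0, ∀ᶠ k in atTop, ∀ x y, D x y < Dk k x y + θ := by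
    intro θ hθ
    filter_upwards [Metric.tendstoUniformly_iff.1 hunif θ hθ] with k hk x y
    have := hk (x, y)
    rw [Real.dist_eq] at this
    linarith [(abs_lt.1 this).2]
  have hf1 : ∀ x y, |f x - f y| ≤ dist x y := fun x y => (hf x y).trans (cd x y)
  have hfl : LipschitzWith 1 f := LipschitzWith.of_dist_le_mul fun x y => by
    simpa [Real.dist_eq] using hf1 x y
  have hgap : ∀ u v, u ≠ v → (∀ z, D u z + D z v = D u v → z = u ∨ z = v) →
      |f u - f v| ≤ D u v := by
    intro u v huv hz
    have hduv : 0 < dist u v := dist_pos.2 huv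
    have main : ∀ η > 0, η < dist u v / 4 → |f u - f v| ≤ D u v + 3 * η := by
      intro η hη hη2
      let K : Set M := {z | η ≤ dist z u ∧ η ≤ dist z v}
      have hK : IsCompact K := by
        refine IsClosed.isCompact ?_
        have k1 : IsClosed {z : M | η ≤ dist z u} := isClosed_le (by fun_prop) (by fun_prop)
        have k2 : IsClosed {z : M | η ≤ dist z v} := isClosed_le (by fun_prop) (by fun_prop)
        exact k1.inter k2
      have hθ : ∃ θ > 0, ∀ z ∈ K, D u v + θ ≤ D u z + D z v := by
        rcases K.eq_empty_or_nonempty with h | h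
        · exact ⟨1, one_pos, by simp [h]⟩
        · have hc : Continuous (fun z => D u z + D z v) :=
            (D_cont.comp (Continuous.prodMk continuous_const continuous_id)).add
              (D_cont.comp (Continuous.prodMk continuous_id continuous_const))
          obtain ⟨z, hzK, hzm⟩ := hK.exists_isMinOn h hc.continuousOn
          refine ⟨D u z + D z v - D u v, ?_, ?_⟩
          · have h1 := D_t u z v
            rcases h1.lt_or_eq with h2 | h2
            · linarith
            · exfalso
              rcases hz z h2.symm with rfl | rfl
              · have := hzK.1; simp at this; linarith
              · have := hzK.2; simp at this; linarith
          · intro w hw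
            have := hzm hw
            simp only [mem_ofPred_eq] at this
            linarith
      obtain ⟨θ, hθ, hθK⟩ := hθ
      have h1 : ∀ᶠ k : ℕ in atTop, 1 / ((k : ℝ) + 1) < dist u v / 4 :=
        tendsto_one_div_add_atTop_nhds_zero_nat.eventually_lt_const (by positivity)
      obtain ⟨k, hk1, hk2⟩ := (h1.and (hU (θ / 4) (by positivity))).exists
      obtain ⟨a, b, ha, hb, hab⟩ := cD_jump (ck0 k) (S := ball u η) (x := u) (y := v)
        (mem_ball_self hη) (by rw [mem_ball, dist_comm]; linarith) (θ := min (θ / 4) η)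
        (lt_min (by positivity) hη)
      change Dk k u a + ck k a b + Dk k b v < Dk k u v + _ at hab
      have m1 := min_le_left (θ / 4) η
      have m2 := min_le_right (θ / 4) η
      rw [mem_ball] at ha hb
      have hbv : dist b v < η := by
        by_contra hcon
        push Not at hcon hb
        have h2 := hθK b ⟨hb, hcon⟩
        linarith [hk2 u b, hk2 b v, D_ge k u v, Dk_t k u a b, Dk_ck k a b]
      have hab1 : dist u v ≤ dist a u + dist a b + dist b v := by
        have := dist_triangle4 u a b v
        rwa [dist_comm u a] at this
      have hckab : ck k a b = c a b := by
        have : ¬ dist a b < 1 / ((k : ℝ) + 1) := by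
          push Not; linarith
        simp only [ck, if_neg this]
      have e1 := hf a b
      have e2 := hf1 a u
      have e3 := hf1 b v
      have e4 : |f u - f v| ≤ |f a - f b| + |f a - f u| + |f b - f v| := by
        have : f u - f v = (f a - f b) - (f a - f u) + (f b - f v) := by ring
        rw [this]
        exact (abs_add_le _ _).trans (add_le_add (abs_sub _ _) le_rfl)
      linarith [D_ge k u v, Dk_nn k u a, Dk_nn k b v]
    by_contra hcon
    push Not at hcon
    have := main (min (dist u v / 8) ((|f u - f v| - D u v) / 6))
      (lt_min (by positivity) (by linarith))
      (by have := min_le_left (dist u v / 8) ((|f u - f v| - D u v) / 6); linarith)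
    have := min_le_right (dist u v / 8) ((|f u - f v| - D u v) / 6)
    linarith
  have hfD : ∀ x y, f y - f x ≤ D x y := geod hM he D_0 D_s D_t D_e D_d hfl hgap
  obtain ⟨k, hk⟩ := (hU τ hτ).exists
  have hfk : ∀ x y, f x - τ ≤ f y + Dk k x y := by
    intro x y
    linarith [hk x y, hfD y x, D_s x y]
  have hbdd : ∀ x, BddBelow (range fun y => f y + Dk k x y) := fun x =>
    ⟨f x - τ, by rintro _ ⟨y, rfl⟩; exact hfk x y⟩
  refine ⟨1 / ((k : ℝ) + 1), by positivity, fun x => ⨅ y, (f y + Dk k x y), ?_, ?_⟩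
  · intro x
    have : Nonempty M := ⟨x⟩
    have h1 : f x - τ ≤ ⨅ y, (f y + Dk k x y) := le_ciInf (hfk x)
    have h2 := ciInf_le (hbdd x) x
    simp only [Dk_0] at h2
    rw [abs_le]
    constructor <;> linarith
  · intro x x'
    have : Nonempty M := ⟨x⟩
    have hone : ∀ x x', (⨅ y, (f y + Dk k x y)) - Dk k x x' ≤ ⨅ y, (f y + Dk k x' y) := by
      intro x x'
      refine le_ciInf fun y => ?_
      have := ciInf_le (hbdd x) y
      linarith [Dk_t k x x' y]
    have h1 := hone x x'
    have h2 := hone x' x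
    have h3 := Dk_ck k x x'
    have h4 := Dk_s k x x'
    change _ ≤ ck k x x'
    rw [abs_le]
    constructor <;> linarith

open Filter Topology in
lemma forward {M : Type*} [MetricSpace M] [CompactSpace M] [MeasurableSpace M] [BorelSpace M]
    (hM : Purely1Unrectifiable M) (f : M → ℝ) (hf : LipschitzWith 1 f) (ε : ℝ) (hε : 0 < ε) :
    ∃ g : M → ℝ, LipschitzWith 1 g ∧ LocallyFlat g ∧ ∀ x : M, |f x - g x| ≤ ε := by
  let P : ℕ → (M → M → ℝ) × (M → ℝ) → Prop := fun n s =>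
    (∀ x y, s.1 x y = s.1 y x) ∧ (∀ x y, (1 / 2 : ℝ) ^ n * dist x y ≤ s.1 x y) ∧
    (∀ x y, s.1 x y ≤ dist x y) ∧ (∀ x y, |s.2 x - s.2 y| ≤ s.1 x y)
  let R : ℕ → (M → M → ℝ) × (M → ℝ) → (M → M → ℝ) × (M → ℝ) → Prop := fun n s t =>
    (∀ x y, t.1 x y ≤ s.1 x y) ∧ (∀ x, dist (s.2 x) (t.2 x) ≤ ε / 2 / 2 ^ n) ∧
    ∃ δ > 0, ∀ x y, dist x y < δ → t.1 x y ≤ (1 / 2 : ℝ) ^ (n + 1) * dist x y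
  have hstep : ∀ n s, ∃ t, P n s → P (n + 1) t ∧ R n s t := by
    intro n s
    by_cases hs : P n s
    · obtain ⟨h1, h2, h3, h4⟩ := hs
      have h2' : ∀ x y, (1 / 2 : ℝ) ^ (n + 1) * dist x y ≤ s.1 x y := by
        intro x y
        refine le_trans (mul_le_mul_of_nonneg_right ?_ dist_nonneg) (h2 x y)
        exact pow_le_pow_of_le_one (by norm_num) (by norm_num) (Nat.le_succ n)
      obtain ⟨δ, hδ, g, hg1, hg2⟩ := flat_step hM (e := (1 / 2 : ℝ) ^ (n + 1)) (by positivity)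
        h1 h2' h3 h4 (τ := ε / 2 / 2 ^ n) (by positivity)
      have hle : ∀ x y, (if dist x y < δ then (1 / 2 : ℝ) ^ (n + 1) * dist x y else s.1 x y) ≤ s.1 x y := by
        intro x y
        split_ifs
        · exact h2' x y
        · exact le_rfl
      refine ⟨(fun x y => if dist x y < δ then (1 / 2 : ℝ) ^ (n + 1) * dist x y else s.1 x y, g),
        fun _ => ⟨⟨?_, ?_, ?_, hg2⟩, hle, ?_, δ, hδ, ?_⟩⟩
      · intro x y
        simp only [dist_comm x y, h1 x y]
      · intro x y
        simp only
        split_ifs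
        · exact le_rfl
        · exact h2' x y
      · intro x y
        exact (hle x y).trans (h3 x y)
      · intro x
        exact hg1 x
      · intro x y hxy
        simp only [if_pos hxy, le_refl]
    · exact ⟨s, fun h => absurd h hs⟩
  choose F hF using hstep
  let S : ℕ → (M → M → ℝ) × (M → ℝ) := fun n => Nat.rec (fun x y => dist x y, f) (fun n s => F n s) n
  have hf1 : ∀ x y, |f x - f y| ≤ dist x y := fun x y => by
    simpa [Real.dist_eq] using hf.dist_le_mul x y
  have hP : ∀ n, P n (S n) := by
    intro n
    induction n with
    | zero => exact ⟨fun x y => dist_comm x y, fun x y => by simp [S], fun x y => le_rfl, hf1⟩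
    | succ n ih => exact (hF n (S n) ih).1
  have hR : ∀ n, R n (S n) (S (n + 1)) := fun n => (hF n (S n) (hP n)).2
  have hanti : ∀ x y, Antitone (fun n => (S n).1 x y) := fun x y =>
    antitone_nat_of_succ_le fun n => (hR n).1 x y
  have hlim : ∀ x, ∃ l, Tendsto (fun n => (S n).2 x) atTop (𝓝 l) := fun x =>
    cauchySeq_tendsto_of_complete (cauchySeq_of_le_geometric_two (C := ε) fun n => (hR n).2.1 x)
  choose g hg using hlim
  have hgS : ∀ n x y, |g x - g y| ≤ (S n).1 x y := by
    intro n x y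
    refine le_of_tendsto ((hg x).sub (hg y)).abs ?_
    filter_upwards [eventually_ge_atTop n] with m hm
    exact ((hP m).2.2.2 x y).trans (hanti x y hm)
  refine ⟨g, ?_, ?_, ?_⟩
  · refine LipschitzWith.of_dist_le_mul fun x y => ?_
    rw [Real.dist_eq, NNReal.coe_one, one_mul]
    exact hgS 0 x y
  · intro p η hη
    obtain ⟨n, hn⟩ := exists_pow_lt_of_lt_one hη (by norm_num : (1 / 2 : ℝ) < 1)
    obtain ⟨-, -, δ, hδ, h⟩ := hR n
    refine ⟨δ / 2, by positivity, fun x y hx hy => ?_⟩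
    have hxy : dist x y < δ := by
      have := dist_triangle_right x y p
      linarith
    refine ((hgS (n + 1) x y).trans (h x y hxy)).trans (mul_le_mul_of_nonneg_right ?_ dist_nonneg)
    exact (pow_le_pow_of_le_one (by norm_num) (by norm_num) (Nat.le_succ n)).trans hn.le
  · intro x
    exact dist_le_of_le_geometric_two_of_tendsto₀ (C := ε) (fun n => (hR n).2.1 x) (hg x)

lemma flat_line {A : Set ℝ} (hA : IsCompact A) {h : ℝ → ℝ} {L η δ : ℝ} (hL : 0 ≤ L) (hδ : 0 < δ)
    (hl : ∀ u ∈ A, ∀ v ∈ A, |h u - h v| ≤ L * |u - v|)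
    (hη : ∀ u ∈ A, ∀ v ∈ A, |u - v| < δ → |h u - h v| ≤ η * |u - v|) (hη0 : 0 ≤ η)
    {s t : ℝ} (hs : s ∈ A) (ht : t ∈ A) (hst : s ≤ t) :
    h t - h s ≤ η * (t - s) + L * volume.real (Icc s t \ A) := by
  let q : ℝ → ℝ := fun v => volume.real (Icc s v \ A)
  have hfin : ∀ v, volume (Icc s v \ A) ≠ ⊤ := fun v =>
    ((measure_mono sdiff_subset).trans_lt (by simp)).ne
  have qmono : ∀ u v, u ≤ v → q u ≤ q v := fun u v huv =>
    measureReal_mono (sdiff_subset_sdiff_left (Icc_subset_Icc_right huv)) (hfin v)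
  let S := {v | v ∈ A ∧ v ≤ t ∧ h v - h s ≤ η * (v - s) + L * q v}
  have hsS : s ∈ S := ⟨hs, hst, by
    have : 0 ≤ L * q s := mul_nonneg hL measureReal_nonneg
    linarith⟩
  have hbdd : BddAbove S := ⟨t, fun v hv => hv.2.1⟩
  have hfw : ∀ v ∈ S, ∀ w ∈ A, v ≤ w → w < v + δ → w ≤ t → w ∈ S := by
    intro v hv w hw hvw hwd hwt
    refine ⟨hw, hwt, ?_⟩
    have h1 := hη w hw v hv.1 (by rw [abs_of_nonneg (by linarith)]; linarith)
    rw [abs_of_nonneg (by linarith : 0 ≤ w - v)] at h1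
    have h2 := mul_le_mul_of_nonneg_left (qmono v w hvw) hL
    linarith [(abs_le.1 h1).2, hv.2.2]
  set σ := sSup S with hσ
  have hσA : σ ∈ A := by
    have : σ ∈ closure S := csSup_mem_closure ⟨s, hsS⟩ hbdd
    exact hA.isClosed.closure_subset_iff.2 (fun v hv => hv.1) this
  have hσt : σ ≤ t := csSup_le ⟨s, hsS⟩ fun v hv => hv.2.1
  have hsσ : s ≤ σ := le_csSup hbdd hsS
  have hσS : σ ∈ S := by
    obtain ⟨v, hv, hvσ⟩ := exists_lt_of_lt_csSup ⟨s, hsS⟩ (show σ - δ < sSup S by linarith)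
    exact hfw v hv σ hσA (le_csSup hbdd hv) (by linarith) hσt
  rcases hσt.lt_or_eq with hlt | heq
  · exfalso
    have hno : ∀ w ∈ A, σ < w → w ≤ t → σ + δ ≤ w := by
      intro w hw hσw hwt
      by_contra hcon
      push Not at hcon
      exact absurd (le_csSup hbdd (hfw σ hσS w hw hσw.le hcon hwt)) (not_le.2 hσw)
    have hA2 : IsCompact (A ∩ Icc (σ + δ) t) := hA.inter_right isClosed_Icc
    obtain ⟨w, hw, hwm⟩ := hA2.exists_isLeast ⟨t, ht, hno t ht hlt le_rfl, le_rfl⟩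
    have hw1 : σ + δ ≤ w := hw.2.1
    have hgap : ∀ r ∈ A, ¬ (σ < r ∧ r < w) := fun r hr h =>
      absurd (hwm ⟨hr, hno r hr h.1 (h.2.le.trans hw.2.2), h.2.le.trans hw.2.2⟩) (not_le.2 h.2)
    have hq : q σ + (w - σ) ≤ q w := by
      have h1 : (Icc s σ \ A) ∪ Ioo σ w ⊆ Icc s w \ A := by
        rintro r (hr | hr)
        · exact ⟨⟨hr.1.1, by linarith [hr.1.2]⟩, hr.2⟩
        · exact ⟨⟨by linarith [hr.1], hr.2.le⟩, fun hrA => hgap r hrA hr⟩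
      have h2 : Disjoint (Icc s σ \ A) (Ioo σ w) := by
        rw [Set.disjoint_left]
        intro r hr hr'
        linarith [hr.1.2, hr'.1]
      have h3 := measureReal_mono (μ := volume) h1 (hfin w)
      rw [measureReal_union h2 measurableSet_Ioo (hfin σ) (by simp),
        Real.volume_real_Ioo_of_le (by linarith)] at h3
      exact h3
    have hwS : w ∈ S := by
      refine ⟨hw.1, hw.2.2, ?_⟩
      have h1 := hl w hw.1 σ hσA
      rw [abs_of_nonneg (by linarith : 0 ≤ w - σ)] at h1
      have h2 := mul_le_mul_of_nonneg_left hq hL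
      have h3 : 0 ≤ η * (w - σ) := mul_nonneg hη0 (by linarith)
      linarith [(abs_le.1 h1).2, hσS.2.2]
    linarith [le_csSup hbdd hwS]
  · have := hσS.2.2
    rwa [heq] at this

lemma flat_uniform {M : Type*} [MetricSpace M] [CompactSpace M] {g : M → ℝ} (hg : LocallyFlat g)
    {η : ℝ} (hη : 0 < η) : ∃ δ > 0, ∀ x y, dist x y < δ → |g x - g y| ≤ η * dist x y := by
  choose δ hδ h using fun p => hg p η hη
  obtain ⟨r, hr, hr'⟩ := lebesgue_number_lemma_of_metric (isCompact_univ (X := M))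
    (c := fun p => ball p (δ p)) (fun p => isOpen_ball)
    (fun p _ => mem_iUnion.2 ⟨p, mem_ball_self (hδ p)⟩)
  refine ⟨r, hr, fun x y hxy => ?_⟩
  obtain ⟨p, hp⟩ := hr' x (mem_univ x)
  exact h p x y (hp (mem_ball_self hr)) (hp (by rwa [mem_ball, dist_comm]))

lemma dist_bound {M : Type*} [MetricSpace M] [CompactSpace M]
    (H : ∀ f : M → ℝ, LipschitzWith 1 f → ∀ ε : ℝ, 0 < ε →
        ∃ g : M → ℝ, LipschitzWith 1 g ∧ LocallyFlat g ∧ ∀ x : M, |f x - g x| ≤ ε)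
    {A : Set ℝ} (hA : Bornology.IsBounded A) {γ : ℝ → M} {K : ℝ≥0} (hγ : LipschitzOnWith K γ A)
    {s t : ℝ} (hs : s ∈ A) (ht : t ∈ A) (hst : s ≤ t) :
    dist (γ s) (γ t) ≤ K * volume.real (Icc s t \ closure A) := by
  refine le_of_forall_pos_le_add fun ε hε => ?_
  obtain ⟨g, hg1, hg2, hg3⟩ := H (fun z => dist (γ s) z) (LipschitzWith.dist_right _) (ε / 2)
    (half_pos hε)
  have hcomp : LipschitzOnWith K (g ∘ γ) A := by
    simpa using hg1.comp_lipschitzOnWith hγ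
  obtain ⟨h, hh, heq⟩ := hcomp.extend_real
  have key : ∀ η > 0, h t - h s ≤ K * η * (t - s) + K * volume.real (Icc s t \ closure A) := by
    intro η hη
    obtain ⟨δ, hδ, hfl⟩ := flat_uniform hg2 hη
    have hδ' : 0 < δ / (K + 1) := by positivity
    refine flat_line hA.isCompact_closure K.2 hδ' ?_ ?_ (by positivity)
      (subset_closure hs) (subset_closure ht) hst
    · intro u _ v _
      simpa [Real.dist_eq] using hh.dist_le_mul u v
    · intro u hu v hv huv
      have hcl : IsClosed {p : ℝ × ℝ | |h p.1 - h p.2| ≤ K * η * |p.1 - p.2|} := by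
        have := hh.continuous
        exact isClosed_le (by fun_prop) (by fun_prop)
      have hop : IsOpen {p : ℝ × ℝ | |p.1 - p.2| < δ / (K + 1)} :=
        isOpen_lt (by fun_prop) (by fun_prop)
      have hsub : {p : ℝ × ℝ | |p.1 - p.2| < δ / (K + 1)} ∩ (A ×ˢ A) ⊆
          {p : ℝ × ℝ | |h p.1 - h p.2| ≤ K * η * |p.1 - p.2|} := by
        rintro ⟨a, b⟩ ⟨hab, ha, hb⟩
        simp only [mem_ofPred_eq] at hab ha hb ⊢
        rw [← heq ha, ← heq hb]
        have h1 : dist (γ a) (γ b) ≤ K * |a - b| := by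
          simpa [Real.dist_eq] using hγ.dist_le_mul a ha b hb
        have h2 : dist (γ a) (γ b) < δ := by
          rw [lt_div_iff₀ (by positivity)] at hab
          nlinarith [abs_nonneg (a - b)]
        have h3 := hfl _ _ h2
        have h4 := mul_le_mul_of_nonneg_left h1 hη.le
        simp only [Function.comp]
        linarith
      have h5 : (u, v) ∈ closure ({p : ℝ × ℝ | |p.1 - p.2| < δ / (K + 1)} ∩ (A ×ˢ A)) := by
        apply hop.inter_closure
        refine ⟨huv, ?_⟩
        rw [closure_prod_eq]
        exact ⟨hu, hv⟩
      exact closure_minimal hsub hcl h5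
  have key2 : h t - h s ≤ K * volume.real (Icc s t \ closure A) := by
    refine le_of_forall_pos_le_add fun θ hθ => ?_
    have h1 : (0 : ℝ) < K * (t - s) + 1 := by
      have : 0 ≤ (K : ℝ) * (t - s) := mul_nonneg K.2 (by linarith)
      linarith
    have h2 := key (θ / (K * (t - s) + 1)) (by positivity)
    have h3 : (K : ℝ) * (θ / (K * (t - s) + 1)) * (t - s) ≤ θ := by
      have : (K : ℝ) * (θ / (K * (t - s) + 1)) * (t - s) = θ * ((K * (t - s)) / (K * (t - s) + 1)) := by
        ring
      rw [this]
      refine mul_le_of_le_one_right hθ.le ?_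
      rw [div_le_one h1]
      linarith
    linarith
  rw [← heq hs, ← heq ht] at key2
  simp only [Function.comp] at key2
  have e1 := hg3 (γ s)
  have e2 := hg3 (γ t)
  simp only [dist_self] at e1
  linarith [(abs_le.1 e1).1, (abs_le.1 e2).2]

open Filter Topology in
lemma backward_bdd {M : Type*} [MetricSpace M] [CompactSpace M] [MeasurableSpace M] [BorelSpace M]
    (H : ∀ f : M → ℝ, LipschitzWith 1 f → ∀ ε : ℝ, 0 < ε →
        ∃ g : M → ℝ, LipschitzWith 1 g ∧ LocallyFlat g ∧ ∀ x : M, |f x - g x| ≤ ε)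
    {A : Set ℝ} (hA : Bornology.IsBounded A) {γ : ℝ → M} {K : ℝ≥0} (hγ : LipschitzOnWith K γ A) :
    μH[1] (γ '' A) = 0 := by
  let w : ℕ → ℝ := fun n => 1 / ((n : ℝ) + 1)
  have hw : ∀ n, 0 < w n := fun n => by positivity
  have hw0 : Tendsto w atTop (𝓝 0) := tendsto_one_div_add_atTop_nhds_zero_nat
  let I : ℕ → ℤ → Set ℝ := fun n i => Ico (i • w n) ((i + 1) • w n)
  let E : ℕ → Set ℝ := fun n => cthickening (w n) (closure A) \ closure A
  have hdist : ∀ s ∈ A, ∀ t ∈ A, ∀ n i, s ∈ I n i → t ∈ I n i → s ≤ t →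
      edist (γ s) (γ t) ≤ K * volume (I n i ∩ E n) := by
    intro s hs t ht n i hsI htI hst
    have h1 := dist_bound H hA hγ hs ht hst
    have hfin : volume (Icc s t \ closure A) ≠ ⊤ :=
      ((measure_mono sdiff_subset).trans_lt (by simp)).ne
    have h2 : edist (γ s) (γ t) ≤ K * volume (Icc s t \ closure A) := by
      rw [edist_dist]
      refine (ENNReal.ofReal_le_ofReal h1).trans ?_
      rw [ENNReal.ofReal_mul (NNReal.coe_nonneg K), ofReal_measureReal hfin, ENNReal.ofReal_coe_nnreal]
    refine h2.trans ?_
    gcongr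
    intro r hr
    refine ⟨⟨hsI.1.trans hr.1.1, hr.1.2.trans_lt htI.2⟩, ?_, hr.2⟩
    refine mem_cthickening_of_dist_le r s _ _ (subset_closure hs) ?_
    rw [Real.dist_eq, abs_of_nonneg (by linarith [hr.1.1])]
    have h3 := hsI.1
    have h4 := htI.2
    rw [add_smul, one_smul] at h4
    linarith [hr.1.2]
  have hdiam : ∀ n i, ediam (γ '' (A ∩ I n i)) ≤ K * volume (I n i ∩ E n) := by
    intro n i
    apply ediam_le
    rintro _ ⟨s, hs, rfl⟩ _ ⟨t, ht, rfl⟩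
    rcases le_total s t with h | h
    · exact hdist s hs.1 t ht.1 n i hs.2 ht.2 h
    · rw [edist_comm]
      exact hdist t ht.1 s hs.1 n i ht.2 hs.2 h
  have hcomp : IsCompact (closure A) := hA.isCompact_closure
  have hEm : ∀ n, MeasurableSet (E n) := fun n =>
    isClosed_cthickening.measurableSet.diff hcomp.isClosed.measurableSet
  have hE0 : Tendsto (fun n => (K : ℝ≥0∞) * volume (E n)) atTop (𝓝 0) := by
    have h1 := (tendsto_measure_cthickening_of_isCompact (μ := volume) hcomp).comp hw0
    have h2 : ∀ n, volume (E n) = volume (cthickening (w n) (closure A)) - volume (closure A) :=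
      fun n => measure_sdiff (self_subset_cthickening _) hcomp.isClosed.measurableSet.nullMeasurableSet
        hcomp.measure_lt_top.ne
    have h3 : Tendsto (fun n => volume (E n)) atTop (𝓝 0) := by
      simp only [h2]
      have := ENNReal.Tendsto.sub h1 (tendsto_const_nhds (x := volume (closure A)))
        (Or.inl hcomp.measure_lt_top.ne)
      simpa using this
    simpa using ENNReal.Tendsto.const_mul h3 (Or.inr ENNReal.coe_ne_top)
  have hIdisj : ∀ n, Pairwise (Function.onFun Disjoint (I n)) := fun n => pairwise_disjoint_Ico_zsmul (w n)
  have hsum : ∀ n, ∑' i, ediam (γ '' (A ∩ I n i)) ^ (1 : ℝ) ≤ K * volume (E n) := by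
    intro n
    calc ∑' i, ediam (γ '' (A ∩ I n i)) ^ (1 : ℝ) ≤ ∑' i, K * volume (I n i ∩ E n) := by
          refine ENNReal.tsum_le_tsum fun i => ?_
          rw [ENNReal.rpow_one]
          exact hdiam n i
      _ = K * ∑' i, volume (I n i ∩ E n) := ENNReal.tsum_mul_left
      _ = K * volume (⋃ i, (I n i ∩ E n)) := by
          rw [measure_iUnion]
          · intro i j hij
            exact (hIdisj n hij).mono inter_subset_left inter_subset_left
          · exact fun i => measurableSet_Ico.inter (hEm n)
      _ ≤ K * volume (E n) := by
          gcongr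
          exact iUnion_subset fun i => inter_subset_right
  have hle := Measure.hausdorffMeasure_le_liminf_tsum (X := M) (ι := fun _ : ℕ => ℤ) 1 (γ '' A)
    (l := atTop) (fun n => (K : ℝ≥0∞) * volume (E n)) hE0 (fun n i => γ '' (A ∩ I n i))
    (Eventually.of_forall fun n i => (hdiam n i).trans (by gcongr; exact inter_subset_right))
    (Eventually.of_forall fun n => by
      rintro _ ⟨s, hs, rfl⟩
      have : s ∈ ⋃ i : ℤ, I n i := by
        have := iUnion_Ico_zsmul (hw n)
        change s ∈ ⋃ i : ℤ, Ico (i • w n) ((i + 1) • w n)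
        rw [this]; trivial
      obtain ⟨i, hi⟩ := mem_iUnion.1 this
      exact mem_iUnion.2 ⟨i, s, ⟨hs, hi⟩, rfl⟩)
  refine le_antisymm (hle.trans ?_) bot_le
  calc _ ≤ liminf (fun n => (K : ℝ≥0∞) * volume (E n)) atTop :=
        liminf_le_liminf (Eventually.of_forall hsum)
    _ = 0 := hE0.liminf_eq

lemma backward {M : Type*} [MetricSpace M] [CompactSpace M] [MeasurableSpace M] [BorelSpace M]
    (H : ∀ f : M → ℝ, LipschitzWith 1 f → ∀ ε : ℝ, 0 < ε →
        ∃ g : M → ℝ, LipschitzWith 1 g ∧ LocallyFlat g ∧ ∀ x : M, |f x - g x| ≤ ε) :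
    Purely1Unrectifiable M := by
  intro A γ K hγ
  have : γ '' A = ⋃ n : ℕ, γ '' (A ∩ closedBall 0 n) := by
    rw [← image_iUnion, ← inter_iUnion, iUnion_closedBall_nat, inter_univ]
  rw [this, measure_iUnion_null_iff]
  intro n
  exact backward_bdd H (isBounded_closedBall.subset inter_subset_right)
    (hγ.mono inter_subset_left)


/-- **Theorem A'.** A compact metric space `M` is purely 1-unrectifiable if and only if the
1-Lipschitz locally flat functions are uniformly (sup-norm) dense in the 1-Lipschitz
functions on `M`. -/
theorem purely1Unrectifiable_iff_locallyFlat_dense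
    {M : Type*} [MetricSpace M] [CompactSpace M] [MeasurableSpace M] [BorelSpace M] :
    Purely1Unrectifiable M ↔
      ∀ f : M → ℝ, LipschitzWith 1 f → ∀ ε : ℝ, 0 < ε →
        ∃ g : M → ℝ, LipschitzWith 1 g ∧ LocallyFlat g ∧ ∀ x : M, |f x - g x| ≤ ε := by
  exact ⟨fun hM f hf ε hε => forward hM f hf ε hε, backward⟩
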